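/- Let χ be a nonprincipal Dirichlet character modulo a monic Q ∈ F_q[t] such that all reciprocal zeros α of the polynomial L(u,χ) satisfy |α| = q^{1/2} (Weil's Riemann hypothesis). Then Θ(n,χ) = Σ_{P monic irreducible, deg P ≤ n} χ(P)·deg P satisfies |Θ(n,χ)| ≤ C·(deg Q)·q^{n/2} + C·q^{n/3} for an absolute constant C (depending only on q), for all n ≥ 1. -/

import Mathlib

open Polynomial

theorem pow_dvd_iff_le_count_normalizedFactors {K : Type*} [Field K]
    [DecidableEq K] [DecidableEq K[X]] {P F : K[X]}
    (hP : P.Monic) (hPi : Irreducible P) (hF : F ≠ 0) (j : ℕ) :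
    P ^ j ∣ F ↔ j ≤ (UniqueFactorizationMonoid.normalizedFactors F).count P := by
  rw [← Nat.cast_le (α := ℕ∞), ← hP.normalize_eq_self,
    ← UniqueFactorizationMonoid.emultiplicity_eq_count_normalizedFactors hPi hF,
    hP.normalize_eq_self, pow_dvd_iff_le_emultiplicity]

section MonicSums

variable {K : Type*} [Field K] [Fintype K]

theorem finite_monic_natDegree_eq (m : ℕ) :
    {f : K[X] | f.Monic ∧ f.natDegree = m}.Finite :=
  Set.finite_coe_iff.mp <| Finite.of_equiv (Fin m → K)
    ((monicEquivDegreeLT m).trans (degreeLTEquiv K m).toEquiv).symm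

/-- The monic polynomials of degree `m` over a finite field. -/
noncomputable def monicOfDegree (K : Type*) [Field K] [Fintype K] (m : ℕ) : Finset K[X] :=
  (finite_monic_natDegree_eq (K := K) m).toFinset

theorem mem_monicOfDegree {m : ℕ} {f : K[X]} :
    f ∈ monicOfDegree K m ↔ f.Monic ∧ f.natDegree = m := by
  simp [monicOfDegree]

theorem card_monicOfDegree (m : ℕ) : (monicOfDegree K m).card = Fintype.card K ^ m := by
  have h := Nat.card_congr ((monicEquivDegreeLT (R := K) m).trans (degreeLTEquiv K m).toEquiv)
  rw [Nat.card_eq_fintype_card (α := Fin m → K), Fintype.card_fun, Fintype.card_fin] at h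
  rw [← h]
  exact (Nat.card_eq_card_finite_toFinset (finite_monic_natDegree_eq (K := K) m)).symm

/-- The monic irreducible polynomials of degree at most `n` over a finite field. -/
noncomputable def monicIrreducibles (K : Type*) [Field K] [Fintype K] (n : ℕ) : Finset K[X] :=
  open Classical in
  ((Finset.range (n + 1)).biUnion (monicOfDegree K)).filter Irreducible

theorem mem_monicIrreducibles {n : ℕ} {P : K[X]} :
    P ∈ monicIrreducibles K n ↔ P.Monic ∧ Irreducible P ∧ P.natDegree ≤ n := by
  simp only [monicIrreducibles, Finset.mem_filter, Finset.mem_biUnion, Finset.mem_range,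
    mem_monicOfDegree]
  grind

/-- The pairs `(P, j)` with `P` monic irreducible, `j ≥ 1` and `deg (P ^ j) = k`. -/
noncomputable def primePowerPairs (K : Type*) [Field K] [Fintype K] (k : ℕ) :
    Finset (K[X] × ℕ) :=
  (monicIrreducibles K k ×ˢ Finset.Icc 1 k).filter fun x ↦ x.1.natDegree * x.2 = k

theorem mem_primePowerPairs {k : ℕ} {x : K[X] × ℕ} :
    x ∈ primePowerPairs K k ↔
      x.1.Monic ∧ Irreducible x.1 ∧ 1 ≤ x.2 ∧ x.1.natDegree * x.2 = k := by
  simp only [primePowerPairs, Finset.mem_filter, Finset.mem_product, mem_monicIrreducibles,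
    Finset.mem_Icc]
  constructor
  · tauto
  · rintro ⟨h1, h2, h3, h4⟩
    have := h2.natDegree_pos
    refine ⟨⟨⟨h1, h2, ?_⟩, h3, ?_⟩, h4⟩ <;> nlinarith

open Classical in
theorem natDegree_eq_sum_primePowerPairs {m : ℕ} {F : K[X]} (hF : F ∈ monicOfDegree K m) :
    m = ∑ k ∈ Finset.range (m + 1),
      ∑ x ∈ (primePowerPairs K k).filter (fun x ↦ x.1 ^ x.2 ∣ F), x.1.natDegree := by
  obtain ⟨hFm, hFd⟩ := mem_monicOfDegree.mp hF
  set s := UniqueFactorizationMonoid.normalizedFactors F with hs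
  have hsmem : ∀ P, P ∈ s ↔ P.Monic ∧ Irreducible P ∧ P ∣ F := by
    intro P
    rw [hs, Polynomial.mem_normalizedFactors_iff hFm.ne_zero]
    tauto
  have hcount : ∀ {P : K[X]}, P.Monic → Irreducible P → ∀ j, P ^ j ∣ F ↔ j ≤ s.count P :=
    fun h1 h2 j ↦ pow_dvd_iff_le_count_normalizedFactors h1 h2 hFm.ne_zero j
  have hdeg : ∀ {P : K[X]} {j : ℕ}, P ^ j ∣ F → P.natDegree * j ≤ m := by
    intro P j h
    have := natDegree_le_of_dvd h hFm.ne_zero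
    rw [natDegree_pow, hFd] at this
    linarith
  let E := (s.toFinset ×ˢ Finset.Icc 1 m).filter fun x ↦ x.1 ^ x.2 ∣ F
  have hE : ∀ k, (primePowerPairs K k).filter (fun x ↦ x.1 ^ x.2 ∣ F) =
      E.filter fun x ↦ x.1.natDegree * x.2 = k := by
    intro k
    ext ⟨P, j⟩
    simp only [Finset.mem_filter, mem_primePowerPairs, E, Finset.mem_product,
      Multiset.mem_toFinset, hsmem, Finset.mem_Icc]
    constructor
    · rintro ⟨⟨h1, h2, h3, h4⟩, h5⟩
      have := h2.natDegree_pos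
      have := hdeg h5
      refine ⟨⟨⟨⟨h1, h2, (dvd_pow_self P (by omega)).trans h5⟩, h3, by nlinarith⟩, h5⟩, h4⟩
    · tauto
  simp_rw [hE]
  rw [Finset.sum_fiberwise_of_maps_to (g := fun x : K[X] × ℕ ↦ x.1.natDegree * x.2)]
  · have hprod : s.prod = F := by
      rw [hs, UniqueFactorizationMonoid.prod_normalizedFactors_eq hFm.ne_zero,
        hFm.normalize_eq_self]
    have h1 : m = ∑ P ∈ s.toFinset, s.count P • P.natDegree := by
      rw [← Finset.sum_multiset_map_count, ← natDegree_multiset_prod_of_monic, hprod, hFd]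
      exact fun P hP ↦ ((hsmem P).mp hP).1
    rw [Finset.sum_filter, Finset.sum_product]
    conv_lhs => rw [h1]
    refine Finset.sum_congr rfl fun P hP ↦ ?_
    obtain ⟨hP1, hP2, hP3⟩ := (hsmem P).mp (Multiset.mem_toFinset.mp hP)
    rw [← Finset.sum_filter]
    dsimp only
    rw [Finset.sum_const]
    congr 1
    have : (Finset.Icc 1 m).filter (fun j ↦ P ^ j ∣ F) = Finset.Icc 1 (s.count P) := by
      ext j
      simp only [Finset.mem_filter, Finset.mem_Icc, ← hcount hP1 hP2]
      constructor
      · tauto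
      · rintro ⟨h1, h2⟩
        have := hdeg h2
        have := hP2.natDegree_pos
        exact ⟨⟨h1, by nlinarith⟩, h2⟩
    rw [this, Nat.card_Icc]
    omega
  · rintro ⟨P, j⟩ h
    have := hdeg (Finset.mem_filter.mp h).2
    exact Finset.mem_range_succ_iff.mpr this

/-- The sum of `g` over monic polynomials of degree `m`. -/
noncomputable def monicSum (g : K[X] →* ℂ) (m : ℕ) : ℂ := ∑ F ∈ monicOfDegree K m, g F

/-- The sum of `Λ(F) g(F)` over monic polynomials `F` of degree `k`, with `Λ` the
von Mangoldt function of `K[X]`. -/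
noncomputable def vonMangoldtSum (g : K[X] →* ℂ) (k : ℕ) : ℂ :=
  ∑ x ∈ primePowerPairs K k, (x.1.natDegree : ℂ) * g x.1 ^ x.2

theorem sum_filter_dvd_monicOfDegree [DecidableRel (α := K[X]) (· ∣ ·)] (g : K[X] →* ℂ) {D : K[X]}
    (hD : D.Monic) (a : ℕ) :
    ∑ F ∈ (monicOfDegree K (a + D.natDegree)).filter (D ∣ ·), g F = monicSum g a * g D := by
  rw [monicSum, Finset.sum_mul]
  symm
  refine Finset.sum_bij (fun G _ ↦ G * D) ?_ ?_ ?_ ?_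
  · intro G hG
    obtain ⟨h1, h2⟩ := mem_monicOfDegree.mp hG
    rw [Finset.mem_filter, mem_monicOfDegree]
    exact ⟨⟨h1.mul hD, by rw [h1.natDegree_mul hD, h2]⟩, dvd_mul_left _ _⟩
  · intro G _ H _ h
    exact mul_right_cancel₀ hD.ne_zero h
  · intro F hF
    obtain ⟨hF, G, rfl⟩ := Finset.mem_filter.mp hF
    obtain ⟨h1, h2⟩ := mem_monicOfDegree.mp hF
    have hG := hD.of_mul_monic_left h1
    refine ⟨G, mem_monicOfDegree.mpr ⟨hG, ?_⟩, mul_comm _ _⟩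
    rw [hD.natDegree_mul hG] at h2
    omega
  · intro G _
    rw [map_mul]

theorem natCast_mul_monicSum (g : K[X] →* ℂ) (m : ℕ) :
    (m : ℂ) * monicSum g m =
      ∑ p ∈ Finset.HasAntidiagonal.antidiagonal m, monicSum g p.1 * vonMangoldtSum g p.2 := by
  classical
  rw [← Finset.Nat.sum_antidiagonal_swap, Finset.Nat.sum_antidiagonal_eq_sum_range_succ_mk]
  have h1 : (m : ℂ) * monicSum g m = ∑ F ∈ monicOfDegree K m, ∑ k ∈ Finset.range (m + 1),
      ∑ x ∈ primePowerPairs K k, if x.1 ^ x.2 ∣ F then (x.1.natDegree : ℂ) * g F else 0 := by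
    rw [monicSum, Finset.mul_sum]
    refine Finset.sum_congr rfl fun F hF ↦ ?_
    conv_lhs => rw [natDegree_eq_sum_primePowerPairs hF]
    push_cast
    simp_rw [Finset.sum_mul, Finset.sum_filter]
  rw [h1, Finset.sum_comm]
  refine Finset.sum_congr rfl fun k hk ↦ ?_
  rw [Finset.sum_comm]
  simp only [Prod.swap, vonMangoldtSum, Finset.mul_sum]
  refine Finset.sum_congr rfl fun x hx ↦ ?_
  obtain ⟨hx1, hx2, hx3, hx4⟩ := mem_primePowerPairs.mp hx
  have h2 := sum_filter_dvd_monicOfDegree g (hx1.pow x.2) (m - k)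
  rw [natDegree_pow, mul_comm, hx4, Nat.sub_add_cancel (by simpa [Nat.lt_succ_iff] using hk)] at h2
  rw [← Finset.sum_filter, ← Finset.mul_sum, h2, map_pow]
  ring

theorem monicSum_zero (g : K[X] →* ℂ) : monicSum g 0 = 1 := by
  have : monicOfDegree K 0 = {1} := by
    ext f
    rw [mem_monicOfDegree, Finset.mem_singleton]
    exact ⟨fun h ↦ h.1.natDegree_eq_zero.mp h.2, by rintro rfl; simp⟩
  rw [monicSum, this, Finset.sum_singleton, map_one]

theorem vonMangoldtSum_one (k : ℕ) (hk : 1 ≤ k) :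
    vonMangoldtSum (1 : K[X] →* ℂ) k = (Fintype.card K : ℂ) ^ k := by
  obtain ⟨m, rfl⟩ : ∃ m, k = m + 1 := ⟨k - 1, by omega⟩
  have hS : ∀ a, monicSum (1 : K[X] →* ℂ) a = (Fintype.card K : ℂ) ^ a := fun a ↦ by
    simp [monicSum, card_monicOfDegree]
  have h1 := natCast_mul_monicSum (1 : K[X] →* ℂ) m
  have h2 := natCast_mul_monicSum (1 : K[X] →* ℂ) (m + 1)
  rw [Finset.Nat.antidiagonal_succ] at h2
  simp only [Finset.sum_cons, Finset.sum_map, Function.Embedding.prodMap, hS,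
    Function.Embedding.coeFn_mk, Prod.map] at h1 h2
  simp only [Function.Embedding.refl_apply, Nat.succ_eq_add_one, pow_succ, pow_zero, one_mul,
    mul_right_comm _ (Fintype.card K : ℂ), ← Finset.sum_mul, ← h1] at h2
  push_cast at h2
  rw [pow_succ]
  linear_combination -h2

/-- The elementary upper bound in the prime polynomial theorem. -/
theorem sum_natDegree_irreducible_le (d : ℕ) (hd : 1 ≤ d) :
    ∑ P ∈ (monicIrreducibles K d).filter (fun P ↦ P.natDegree = d), P.natDegree ≤
      Fintype.card K ^ d := by
  classical
  have h := vonMangoldtSum_one (K := K) d hd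
  simp only [vonMangoldtSum, MonoidHom.one_apply, one_pow, mul_one] at h
  rw [← show ∑ x ∈ primePowerPairs K d, x.1.natDegree = Fintype.card K ^ d by exact_mod_cast h]
  rw [← Finset.sum_image (f := fun x : K[X] × ℕ ↦ x.1.natDegree) (g := fun P ↦ (P, 1))]
  · refine Finset.sum_le_sum_of_subset ?_
    intro x hx
    obtain ⟨P, hP, rfl⟩ := Finset.mem_image.mp hx
    rw [Finset.mem_filter, mem_monicIrreducibles] at hP
    rw [mem_primePowerPairs]
    simp only [le_refl, mul_one, true_and]
    tauto
  · intro P _ R _ h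
    exact (Prod.ext_iff.mp h).1

end MonicSums

section Character

variable {K : Type*} [Field K]

theorem MulChar.norm_le_one_of_finite {M : Type*} [CommMonoid M] [Finite M] (χ : MulChar M ℂ)
    (a : M) : ‖χ a‖ ≤ 1 := by
  by_cases ha : IsUnit a
  · obtain ⟨u, rfl⟩ := ha
    obtain ⟨k, hk, hu⟩ := (isOfFinOrder_of_finite u).exists_pow_eq_one
    refine ((pow_eq_one_iff_of_nonneg (norm_nonneg _) hk.ne').mp ?_).le
    rw [← norm_pow, ← map_pow, ← Units.val_pow_eq_pow_val, hu, Units.val_one, map_one, norm_one]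
  · simp [χ.map_nonunit ha]

/-- A character modulo `Q`, viewed as a completely multiplicative function on `K[X]`. -/
noncomputable def MulChar.liftPolynomial {Q : K[X]} (χ : MulChar (K[X] ⧸ Ideal.span {Q}) ℂ) :
    K[X] →* ℂ :=
  χ.toMonoidHom.comp (Ideal.Quotient.mk (Ideal.span {Q})).toMonoidHom

theorem MulChar.liftPolynomial_apply {Q : K[X]} (χ : MulChar (K[X] ⧸ Ideal.span {Q}) ℂ)
    (f : K[X]) : χ.liftPolynomial f = χ (Ideal.Quotient.mk (Ideal.span {Q}) f) := rfl

variable [Fintype K]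

theorem finite_quotient_span_of_monic {Q : K[X]} (hQ : Q.Monic) :
    Finite (K[X] ⧸ Ideal.span {Q}) :=
  have := hQ.finite_quotient
  Module.finite_of_finite K

theorem sum_monicOfDegree_add {m : ℕ} {r : K[X]} (hr : r.degree < m) (g : K[X] → ℂ) :
    ∑ F ∈ monicOfDegree K m, g (F + r) = ∑ F ∈ monicOfDegree K m, g F := by
  have key : ∀ {r : K[X]}, r.degree < m → ∀ F ∈ monicOfDegree K m, F + r ∈ monicOfDegree K m := by
    intro r hr F hF
    obtain ⟨h1, h2⟩ := mem_monicOfDegree.mp hF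
    have h3 : r.degree < F.degree := by rwa [degree_eq_natDegree h1.ne_zero, h2]
    exact mem_monicOfDegree.mpr ⟨h1.add_of_left h3, by
      rw [natDegree_add_eq_left_of_degree_lt h3, h2]⟩
  refine Finset.sum_bij' (fun F _ ↦ F + r) (fun F _ ↦ F - r) (key hr) ?_ ?_ ?_ ?_
  · intro F hF
    rw [sub_eq_add_neg]
    exact key (by rwa [degree_neg]) F hF
  all_goals simp

theorem monicSum_liftPolynomial_eq_zero {Q : K[X]} (hQ : Q.Monic)
    {χ : MulChar (K[X] ⧸ Ideal.span {Q}) ℂ} (hχ : χ ≠ 1) {m : ℕ} (hm : Q.natDegree ≤ m) :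
    monicSum χ.liftPolynomial m = 0 := by
  have := finite_quotient_span_of_monic hQ
  have := Fintype.ofFinite (K[X] ⧸ Ideal.span {Q})
  have hshift : ∀ a : K[X] ⧸ Ideal.span {Q}, ∑ F ∈ monicOfDegree K m,
      χ (Ideal.Quotient.mk (Ideal.span {Q}) F + a) = monicSum χ.liftPolynomial m := by
    intro a
    obtain ⟨p, rfl⟩ := Ideal.Quotient.mk_surjective a
    have hp : Ideal.Quotient.mk (Ideal.span {Q}) p = Ideal.Quotient.mk (Ideal.span {Q}) (p %ₘ Q) := by
      rw [Ideal.Quotient.eq, Ideal.mem_span_singleton]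
      exact ⟨p /ₘ Q, by linear_combination (-1 : K[X]) * modByMonic_add_div p Q⟩
    have hr : (p %ₘ Q).degree < m := by
      refine (degree_modByMonic_lt p hQ).trans_le ?_
      rw [degree_eq_natDegree hQ.ne_zero]
      exact_mod_cast hm
    rw [hp, monicSum, ← sum_monicOfDegree_add hr fun F ↦ χ.liftPolynomial F]
    simp only [MulChar.liftPolynomial_apply, map_add]
  have h1 : ∑ a : K[X] ⧸ Ideal.span {Q}, ∑ F ∈ monicOfDegree K m,
      χ (Ideal.Quotient.mk (Ideal.span {Q}) F + a) = 0 := by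
    rw [Finset.sum_comm]
    refine Finset.sum_eq_zero fun F _ ↦ ?_
    rw [← MulChar.sum_eq_zero_of_ne_one hχ]
    exact Fintype.sum_equiv (Equiv.addLeft (Ideal.Quotient.mk (Ideal.span {Q}) F)) _ _ fun _ ↦ rfl
  simp_rw [hshift] at h1
  rw [Finset.sum_const, smul_eq_zero] at h1
  refine h1.resolve_left ?_
  rw [Finset.card_univ]
  exact Fintype.card_ne_zero

end Character

section LogDerivative

/-- The power series `-∑_{k ≥ 1} (∑_{z ∈ s} z⁻ᵏ) Xᵏ`, which is `X p'/p` for a polynomial `p` with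
roots `s`. -/
noncomputable def negInvPowerSums (s : Multiset ℂ) : PowerSeries ℂ :=
  PowerSeries.mk fun k ↦ if k = 0 then 0 else -(s.map fun z ↦ z⁻¹ ^ k).sum

theorem negInvPowerSums_cons (z : ℂ) (s : Multiset ℂ) :
    negInvPowerSums (z ::ₘ s) = negInvPowerSums {z} + negInvPowerSums s := by
  ext k
  by_cases hk : k = 0 <;> simp [negInvPowerSums, hk]
  ring

theorem X_eq_X_sub_C_mul_negInvPowerSums {z : ℂ} (hz : z ≠ 0) :
    (PowerSeries.X : PowerSeries ℂ) =
      (PowerSeries.X - PowerSeries.C z) * negInvPowerSums {z} := by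
  ext k
  rw [sub_mul, map_sub, PowerSeries.coeff_C_mul]
  rcases k with _ | _ | k
  · simp [negInvPowerSums]
  · simp [PowerSeries.coeff_succ_X_mul, negInvPowerSums, hz]
  · simp [PowerSeries.coeff_succ_X_mul, negInvPowerSums, PowerSeries.coeff_X, pow_succ, hz]

theorem X_mul_derivative_prod_X_sub_C (s : Multiset ℂ) (hs : ∀ z ∈ s, z ≠ 0) :
    (PowerSeries.X : PowerSeries ℂ) * ↑(derivative (s.map fun z : ℂ ↦ (X - C z : ℂ[X])).prod) =
      ↑(s.map fun z : ℂ ↦ (X - C z : ℂ[X])).prod * negInvPowerSums s := by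
  induction s using Multiset.induction with
  | empty =>
    have : negInvPowerSums 0 = 0 := by
      ext k
      simp [negInvPowerSums]
    simp [this]
  | cons z s ih =>
    have ih := ih fun w hw ↦ hs w (Multiset.mem_cons_of_mem hw)
    have hz := X_eq_X_sub_C_mul_negInvPowerSums (hs z (Multiset.mem_cons_self z s))
    rw [negInvPowerSums_cons, Multiset.map_cons, Multiset.prod_cons, derivative_mul]
    simp only [derivative_sub, derivative_X, derivative_C, sub_zero, one_mul, coe_add, coe_mul,
      coe_sub, coe_X, coe_C]
    linear_combination (PowerSeries.X - PowerSeries.C z) * ih +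
      (↑(s.map fun z : ℂ ↦ (X - C z : ℂ[X])).prod : PowerSeries ℂ) * hz

theorem X_mul_derivative_eq_mul_negInvPowerSums {p : ℂ[X]} (hp : ∀ z ∈ p.roots, z ≠ 0) :
    (PowerSeries.X : PowerSeries ℂ) * ↑(derivative p) = ↑p * negInvPowerSums p.roots := by
  have h := X_mul_derivative_prod_X_sub_C p.roots hp
  have hsplit := (IsAlgClosed.splits p).eq_prod_roots
  generalize negInvPowerSums p.roots = A at *
  generalize (p.roots.map fun z ↦ X - C z).prod = r at *
  rw [hsplit]
  simp only [derivative_C_mul, coe_mul, coe_C]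
  linear_combination (PowerSeries.C p.leadingCoeff) * h

theorem coeff_eq_neg_sum_inv_roots_pow {p : ℂ[X]} (hp0 : p ≠ 0) (hp : ∀ z ∈ p.roots, z ≠ 0)
    {a : ℕ → ℂ} (ha : ∀ m : ℕ, (m : ℂ) * p.coeff m =
      ∑ x ∈ Finset.HasAntidiagonal.antidiagonal m, p.coeff x.1 * a x.2) {k : ℕ} (hk : 1 ≤ k) :
    a k = -(p.roots.map fun z ↦ z⁻¹ ^ k).sum := by
  have h1 : (PowerSeries.X : PowerSeries ℂ) * ↑(derivative p) = ↑p * PowerSeries.mk a := by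
    ext m
    rw [PowerSeries.coeff_mul m (p : PowerSeries ℂ)]
    simp only [Polynomial.coeff_coe, PowerSeries.coeff_mk, ← ha]
    rcases m with _ | m
    · simp
    · rw [PowerSeries.coeff_succ_X_mul, coeff_coe, coeff_derivative]
      push_cast
      ring
  rw [X_mul_derivative_eq_mul_negInvPowerSums hp] at h1
  have h2 := mul_left_cancel₀ (by exact_mod_cast hp0) h1
  have h3 := congrArg (PowerSeries.coeff k) h2
  rw [PowerSeries.coeff_mk, negInvPowerSums, PowerSeries.coeff_mk, if_neg (by omega)] at h3
  exact h3.symm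

end LogDerivative

section Bounds

variable {K : Type*} [Field K] [Fintype K]

theorem sum_natDegree_monicIrreducibles_le (n : ℕ) :
    ∑ P ∈ monicIrreducibles K n, P.natDegree ≤ 2 * Fintype.card K ^ n := by
  induction n with
  | zero =>
    rw [Finset.sum_eq_zero]
    · positivity
    · exact fun P hP ↦ Nat.le_zero.mp (mem_monicIrreducibles.mp hP).2.2
  | succ n ih =>
    have h1 : (monicIrreducibles K (n + 1)).filter (fun P ↦ ¬ P.natDegree = n + 1) =
        monicIrreducibles K n := by
      ext P
      simp only [Finset.mem_filter, mem_monicIrreducibles]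
      grind
    rw [← Finset.sum_filter_add_sum_filter_not _ (fun P ↦ P.natDegree = n + 1), h1]
    have h2 := sum_natDegree_irreducible_le (K := K) (n + 1) (by omega)
    have h3 : 2 ≤ Fintype.card K := Fintype.one_lt_card
    have h4 : 2 * Fintype.card K ^ n ≤ Fintype.card K ^ (n + 1) := by
      rw [pow_succ, mul_comm]
      gcongr
    omega

theorem sum_properPrimePowers_le (n : ℕ) :
    ∑ k ∈ Finset.range (n + 1), ∑ x ∈ (primePowerPairs K k).filter (fun x ↦ 2 ≤ x.2),
      x.1.natDegree ≤ 2 * Fintype.card K ^ (n / 2) + 2 * n * Fintype.card K ^ (n / 3) := by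
  let W := (monicIrreducibles K n ×ˢ Finset.Icc 2 n).filter fun x ↦ x.1.natDegree * x.2 ≤ n
  have hW : ∀ k ∈ Finset.range (n + 1), (primePowerPairs K k).filter (fun x ↦ 2 ≤ x.2) =
      W.filter fun x ↦ x.1.natDegree * x.2 = k := by
    intro k hk
    ext ⟨P, j⟩
    have hk := Finset.mem_range_succ_iff.mp hk
    simp only [Finset.mem_filter, mem_primePowerPairs, W, Finset.mem_product,
      mem_monicIrreducibles, Finset.mem_Icc]
    constructor
    · rintro ⟨⟨h1, h2, h3, h4⟩, h5⟩
      have := h2.natDegree_pos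
      refine ⟨⟨⟨⟨h1, h2, by nlinarith⟩, h5, by nlinarith⟩, by omega⟩, h4⟩
    · rintro ⟨⟨⟨⟨h1, h2, _⟩, h3, _⟩, _⟩, h4⟩
      exact ⟨⟨h1, h2, by omega, h4⟩, h3⟩
  have hcard : 1 ≤ Fintype.card K := Fintype.card_pos
  rw [Finset.sum_congr rfl fun k hk ↦ by rw [hW k hk],
    Finset.sum_fiberwise_of_maps_to (g := fun x : K[X] × ℕ ↦ x.1.natDegree * x.2)
      (fun x hx ↦ Finset.mem_range_succ_iff.mpr (Finset.mem_filter.mp hx).2),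
    Finset.sum_filter, Finset.sum_product_right]
  calc _ ≤ ∑ j ∈ Finset.Icc 2 n,
        ((if j = 2 then 2 * Fintype.card K ^ (n / 2) else 0) + 2 * Fintype.card K ^ (n / 3)) := by
        refine Finset.sum_le_sum fun j hj ↦ ?_
        have hj := Finset.mem_Icc.mp hj
        have h1 : (monicIrreducibles K n).filter (fun P ↦ P.natDegree * j ≤ n) =
            monicIrreducibles K (n / j) := by
          ext P
          simp only [Finset.mem_filter, mem_monicIrreducibles,
            Nat.le_div_iff_mul_le (show 0 < j by omega)]
          constructor
          · tauto
          · rintro ⟨h1, h2, h3⟩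
            exact ⟨⟨h1, h2, by nlinarith⟩, h3⟩
        rw [← Finset.sum_filter]
        dsimp only
        rw [h1]
        refine (sum_natDegree_monicIrreducibles_le _).trans ?_
        split_ifs with h
        · subst h
          omega
        · rw [zero_add]
          gcongr
          omega
    _ ≤ _ := by
        rw [Finset.sum_add_distrib, Finset.sum_const, Nat.card_Icc, smul_eq_mul, Finset.sum_ite_eq']
        have h2 : (n + 1 - 2) * (2 * Fintype.card K ^ (n / 3)) ≤
            2 * n * Fintype.card K ^ (n / 3) := by
          calc _ ≤ n * (2 * Fintype.card K ^ (n / 3)) := by gcongr; omega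
            _ = _ := by ring
        refine Nat.add_le_add ?_ h2
        split_ifs <;> omega

theorem sum_vonMangoldtSum_eq (g : K[X] →* ℂ) (n : ℕ) :
    ∑ k ∈ Finset.range (n + 1), vonMangoldtSum g k =
      ∑ P ∈ monicIrreducibles K n, g P * P.natDegree +
      ∑ k ∈ Finset.range (n + 1), ∑ x ∈ (primePowerPairs K k).filter (fun x ↦ 2 ≤ x.2),
        (x.1.natDegree : ℂ) * g x.1 ^ x.2 := by
  rw [← Finset.sum_fiberwise_of_maps_to (s := monicIrreducibles K n) (g := natDegree)
      (fun P hP ↦ Finset.mem_range_succ_iff.mpr (mem_monicIrreducibles.mp hP).2.2),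
    ← Finset.sum_add_distrib]
  refine Finset.sum_congr rfl fun k hk ↦ ?_
  have hk := Finset.mem_range_succ_iff.mp hk
  rw [vonMangoldtSum, ← Finset.sum_filter_add_sum_filter_not _ (fun x ↦ 2 ≤ x.2), add_comm]
  congr 1
  symm
  refine Finset.sum_bij' (fun P _ ↦ (P, 1)) (fun x _ ↦ x.1) ?_ ?_ ?_ ?_ ?_
  · intro P hP
    simp only [Finset.mem_filter, mem_monicIrreducibles, mem_primePowerPairs] at hP ⊢
    simp
    tauto
  · rintro ⟨P, j⟩ hx
    simp only [Finset.mem_filter, mem_monicIrreducibles, mem_primePowerPairs] at hx ⊢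
    obtain ⟨⟨h1, h2, h3, h4⟩, h5⟩ := hx
    obtain rfl : j = 1 := by omega
    exact ⟨⟨h1, h2, by omega⟩, by omega⟩
  · simp
  · rintro ⟨P, j⟩ hx
    simp only [Finset.mem_filter, mem_primePowerPairs] at hx
    obtain rfl : j = 1 := by omega
    rfl
  · intro P _
    ring

theorem norm_vonMangoldtSum_le {g : K[X] →* ℂ} {p : ℂ[X]} (hp : ∀ m, p.coeff m = monicSum g m)
    {s : ℝ} (hs : 0 < s) (hroots : ∀ z, p.eval z = 0 → ‖z‖ = s⁻¹) (k : ℕ) :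
    ‖vonMangoldtSum g k‖ ≤ p.natDegree * s ^ k := by
  have hp0 : p ≠ 0 := by
    rintro rfl
    simpa [monicSum_zero] using hp 0
  have hnorm : ∀ z ∈ p.roots, ‖z‖ = s⁻¹ := fun z hz ↦ hroots z ((mem_roots hp0).mp hz)
  rcases Nat.eq_zero_or_pos k with rfl | hk
  · have : primePowerPairs K 0 = ∅ := by
      simp [primePowerPairs]
    rw [vonMangoldtSum, this, Finset.sum_empty, norm_zero]
    positivity
  · rw [coeff_eq_neg_sum_inv_roots_pow hp0 (fun z hz h ↦ ?_) (a := vonMangoldtSum g) ?_ hk, norm_neg]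
    · refine (norm_multiset_sum_le _).trans ?_
      rw [Multiset.map_map, Multiset.map_congr rfl (g := fun _ ↦ s ^ k)]
      · rw [Multiset.map_const', Multiset.sum_replicate, nsmul_eq_mul]
        gcongr
        exact card_roots' p
      · intro z hz
        simp [hnorm z hz]
    · intro m
      simp only [hp]
      exact natCast_mul_monicSum g m
    · have := hnorm z hz
      rw [h, norm_zero] at this
      exact (inv_pos.mpr hs).ne this

theorem sum_range_succ_pow_le {s : ℝ} (hs : 1 < s) (n : ℕ) :
    ∑ k ∈ Finset.range (n + 1), s ^ k ≤ s / (s - 1) * s ^ n := by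
  rw [geom_sum_eq hs.ne', div_mul_eq_mul_div]
  have : 0 < s - 1 := by linarith
  gcongr
  rw [pow_succ]
  linarith

theorem natCast_mul_rpow_div_three_le {q : ℝ} (hq : 1 < q) (n : ℕ) :
    (n : ℝ) * q ^ ((n : ℝ) / 3) ≤ 6 / Real.log q * q ^ ((n : ℝ) / 2) := by
  have hlog := Real.log_pos hq
  have h1 : (n : ℝ) ≤ 6 / Real.log q * q ^ ((n : ℝ) / 6) := by
    have := Real.add_one_le_exp (Real.log q * (n / 6))
    rw [← Real.rpow_def_of_pos (by linarith)] at this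
    rw [div_mul_eq_mul_div, le_div_iff₀ hlog]
    linarith
  calc _ ≤ 6 / Real.log q * q ^ ((n : ℝ) / 6) * q ^ ((n : ℝ) / 3) := by gcongr
    _ = _ := by
      rw [mul_assoc, ← Real.rpow_add (by linarith)]
      ring_nf

theorem norm_sum_properPrimePowers_le {g : K[X] →* ℂ} (hg : ∀ F, ‖g F‖ ≤ 1) (n : ℕ) :
    ‖∑ k ∈ Finset.range (n + 1), ∑ x ∈ (primePowerPairs K k).filter (fun x ↦ 2 ≤ x.2),
        (x.1.natDegree : ℂ) * g x.1 ^ x.2‖ ≤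
      (2 + 12 / Real.log (Fintype.card K)) * (Fintype.card K : ℝ) ^ ((n : ℝ) / 2) := by
  have hq : (1 : ℝ) < Fintype.card K := by exact_mod_cast Fintype.one_lt_card (α := K)
  have hfloor : ∀ j : ℕ, (Fintype.card K : ℝ) ^ (n / j) ≤ (Fintype.card K : ℝ) ^ ((n : ℝ) / j) := by
    intro j
    rw [← Real.rpow_natCast]
    exact Real.rpow_le_rpow_of_exponent_le hq.le Nat.cast_div_le
  have h1 : ‖∑ k ∈ Finset.range (n + 1), ∑ x ∈ (primePowerPairs K k).filter (fun x ↦ 2 ≤ x.2),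
        (x.1.natDegree : ℂ) * g x.1 ^ x.2‖ ≤ ((∑ k ∈ Finset.range (n + 1),
      ∑ x ∈ (primePowerPairs K k).filter (fun x ↦ 2 ≤ x.2), x.1.natDegree : ℕ) : ℝ) := by
    push_cast
    refine norm_sum_le_of_le _ fun k _ ↦ norm_sum_le_of_le _ fun x _ ↦ ?_
    rw [norm_mul, norm_pow, Complex.norm_natCast]
    exact mul_le_of_le_one_right (by positivity) (pow_le_one₀ (norm_nonneg _) (hg _))
  have h2 : ((∑ k ∈ Finset.range (n + 1), ∑ x ∈ (primePowerPairs K k).filter (fun x ↦ 2 ≤ x.2),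
      x.1.natDegree : ℕ) : ℝ) ≤ _ := Nat.cast_le.mpr (sum_properPrimePowers_le (K := K) n)
  refine (h1.trans h2).trans ?_
  push_cast
  have h3 := hfloor 2
  have h4 := mul_le_mul_of_nonneg_left (hfloor 3) (Nat.cast_nonneg (α := ℝ) n)
  have h5 := natCast_mul_rpow_div_three_le hq n
  push_cast at h3 h4
  have h6 : (12 : ℝ) / Real.log (Fintype.card K) = 2 * (6 / Real.log (Fintype.card K)) := by ring
  rw [h6]
  linarith

theorem tsum_subtype_eq_sum_of_mem_iff {α : Type*} {p : α → Prop} (s : Finset α)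
    (h : ∀ x, x ∈ s ↔ p x) (f : α → ℂ) : ∑' x : {x // p x}, f x = ∑ x ∈ s, f x := by
  obtain rfl : (fun x ↦ x ∈ s) = p := funext fun x ↦ propext (h x)
  exact s.tsum_subtype f

end Bounds

/-- **Square-root cancellation from Weil's Riemann hypothesis.**
Let `χ` be a nonprincipal Dirichlet character modulo a monic `Q ∈ F_q[t]`, and let
`Lpoly` be the polynomial with coefficients `Σ_{F monic, deg F = m} χ(F)` (the
`L`-function of `χ`).  If all zeros `z` of `Lpoly` satisfy `|z| = q^{-1/2}`
(equivalently all reciprocal zeros `α` satisfy `|α| = q^{1/2}`), then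
`|Θ(n,χ)| ≤ C·(deg Q)·q^{n/2} + C·q^{n/3}` for a constant `C` depending only
on `q`, for all `n ≥ 1`. -/
theorem theta_bound_of_weil
    {Fq : Type*} [Field Fq] [Fintype Fq] :
    ∃ C : ℝ, 0 < C ∧
      ∀ (Q : Polynomial Fq), Q.Monic → 1 ≤ Q.natDegree →
      ∀ (χ : MulChar (Polynomial Fq ⧸ Ideal.span {Q}) ℂ), χ ≠ 1 →
      ∀ (Lpoly : Polynomial ℂ),
        (∀ m : ℕ, Lpoly.coeff m =
          ∑' f : {f : Polynomial Fq // f.Monic ∧ f.natDegree = m},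
            χ (Ideal.Quotient.mk (Ideal.span {Q}) f.1)) →
        (∀ z : ℂ, Lpoly.eval z = 0 → ‖z‖ = (Fintype.card Fq : ℝ) ^ (-(1 : ℝ) / 2)) →
      ∀ n : ℕ, 1 ≤ n →
        ‖∑' P : {P : Polynomial Fq // P.Monic ∧ Irreducible P ∧ P.natDegree ≤ n},
            χ (Ideal.Quotient.mk (Ideal.span {Q}) P.1) * (P.1.natDegree : ℂ)‖
          ≤ C * Q.natDegree * (Fintype.card Fq : ℝ) ^ ((n : ℝ) / 2) +
              C * (Fintype.card Fq : ℝ) ^ ((n : ℝ) / 3) := by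
  have hq : (1 : ℝ) < Fintype.card Fq := by exact_mod_cast Fintype.one_lt_card (α := Fq)
  have hlog := Real.log_pos hq
  set q : ℝ := (Fintype.card Fq : ℝ)
  have hs : 1 < q ^ ((1 : ℝ) / 2) := Real.one_lt_rpow hq (by norm_num)
  set s := q ^ ((1 : ℝ) / 2) with hsdef
  have hs1 : 0 < s - 1 := by linarith
  have hspow : ∀ n : ℕ, s ^ n = q ^ ((n : ℝ) / 2) := fun n ↦ by
    rw [hsdef, ← Real.rpow_natCast, ← Real.rpow_mul (by linarith)]
    ring_nf
  refine ⟨s / (s - 1) + (2 + 12 / Real.log q), by positivity, ?_⟩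
  intro Q hQ hQ1 χ hχ Lpoly hL hroots n _
  have hcoeff : ∀ m, Lpoly.coeff m = monicSum χ.liftPolynomial m := fun m ↦ by
    rw [hL, tsum_subtype_eq_sum_of_mem_iff (monicOfDegree Fq m) (fun _ ↦ mem_monicOfDegree)
      fun f ↦ χ (Ideal.Quotient.mk (Ideal.span {Q}) f)]
    rfl
  have hdeg : Lpoly.natDegree ≤ Q.natDegree := natDegree_le_iff_coeff_eq_zero.mpr fun m hm ↦ by
    rw [hcoeff, monicSum_liftPolynomial_eq_zero hQ hχ hm.le]
  have hΛ : ∀ k, ‖vonMangoldtSum χ.liftPolynomial k‖ ≤ Q.natDegree * s ^ k := fun k ↦ by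
    refine (norm_vonMangoldtSum_le hcoeff (s := s) (by linarith) (fun z hz ↦ ?_) k).trans ?_
    · rw [hroots z hz, hsdef, ← Real.rpow_neg (by linarith), neg_div]
    · gcongr
  have := finite_quotient_span_of_monic hQ
  have hproper := norm_sum_properPrimePowers_le (g := χ.liftPolynomial)
    (fun F ↦ χ.norm_le_one_of_finite _) n
  have hΨ : ‖∑ k ∈ Finset.range (n + 1), vonMangoldtSum χ.liftPolynomial k‖ ≤
      Q.natDegree * (s / (s - 1) * s ^ n) := by
    refine (norm_sum_le_of_le _ fun k _ ↦ hΛ k).trans ?_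
    rw [← Finset.mul_sum]
    gcongr
    exact sum_range_succ_pow_le hs n
  rw [tsum_subtype_eq_sum_of_mem_iff (monicIrreducibles Fq n) (fun _ ↦ mem_monicIrreducibles)
    fun P ↦ χ (Ideal.Quotient.mk (Ideal.span {Q}) P) * (P.natDegree : ℂ)]
  have hΘ := eq_sub_of_add_eq (sum_vonMangoldtSum_eq χ.liftPolynomial n).symm
  simp only [MulChar.liftPolynomial_apply] at hΘ
  rw [hΘ]
  have hD : (1 : ℝ) ≤ Q.natDegree := by exact_mod_cast hQ1
  calc _ ≤ Q.natDegree * (s / (s - 1) * s ^ n) +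
        (2 + 12 / Real.log q) * q ^ ((n : ℝ) / 2) := (norm_sub_le _ _).trans (add_le_add hΨ hproper)
    _ ≤ Q.natDegree * (s / (s - 1) * s ^ n) +
        Q.natDegree * ((2 + 12 / Real.log q) * q ^ ((n : ℝ) / 2)) :=
      add_le_add le_rfl (le_mul_of_one_le_left (by positivity) hD)
    _ = (s / (s - 1) + (2 + 12 / Real.log q)) * Q.natDegree * q ^ ((n : ℝ) / 2) := by
      rw [hspow]
      ring
    _ ≤ _ := le_add_of_nonneg_right (by positivity)
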